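/- arXiv:1712.05918 — 6 statements merged into one kernel-verified Lean document; each statement's English description precedes it below -/
import Mathlib

section
/- Let n ≥ 2 be an integer, d > 0, and let ρ : [0,d] → ℝ be a C¹ nonnegative function. Then n·∫₀^d ρ(x)^{n−1}·√(1+ρ'(x)²) dx ≥ (max_{[0,d]} ρ)^n − (min_{[0,d]} ρ)^n. -/
open MeasureTheory

/-- If `g` is `C¹` on `[c, d]`, its oscillation is at most the integral of any integrable
majorant of `|g'|`. -/
theorem sub_le_integral_of_abs_deriv_le {c d : ℝ} (hcd : c ≤ d) {g g' f : ℝ → ℝ}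
    (hg : ∀ x ∈ Set.Icc c d, HasDerivWithinAt g (g' x) (Set.Icc c d) x)
    (hg' : ContinuousOn g' (Set.Icc c d))
    (hf : IntervalIntegrable f volume c d)
    (hle : ∀ x ∈ Set.Icc c d, |g' x| ≤ f x)
    {a b : ℝ} (ha : a ∈ Set.Icc c d) (hb : b ∈ Set.Icc c d) :
    g a - g b ≤ ∫ x in c..d, f x := by
  have hsub : Set.uIcc b a ⊆ Set.Icc c d := Set.uIcc_subset_Icc hb ha
  have hftc : ∫ x in b..a, g' x = g a - g b := by
    refine intervalIntegral.integral_eq_sub_of_hasDeriv_right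
      (fun x hx => ((hg x (hsub hx)).continuousWithinAt).mono hsub) (fun x hx => ?_)
      (hg'.mono hsub).intervalIntegrable
    have hx' : x ∈ Set.Ioo c d :=
      ⟨(le_min hb.1 ha.1).trans_lt hx.1, hx.2.trans_le (max_le hb.2 ha.2)⟩
    exact ((hg x (Set.Ioo_subset_Icc_self hx')).hasDerivAt
      (Icc_mem_nhds hx'.1 hx'.2)).hasDerivWithinAt
  have hint : IntervalIntegrable (fun x => |g' x|) volume c d :=
    hg'.abs.intervalIntegrable_of_Icc hcd
  calc g a - g b = ∫ x in b..a, g' x := hftc.symm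
    _ ≤ |∫ x in b..a, g' x| := le_abs_self _
    _ ≤ |∫ x in b..a, (|g' x|)| :=
        intervalIntegral.norm_integral_le_abs_integral_norm (f := g')
    _ ≤ |∫ x in c..d, (|g' x|)| := by
        refine intervalIntegral.abs_integral_mono_interval ?_
          (Filter.Eventually.of_forall fun x => abs_nonneg _) hint
        refine Set.uIoc_subset_uIoc_of_uIcc_subset_uIcc ?_
        rwa [Set.uIcc_of_le hcd]
    _ = ∫ x in c..d, |g' x| :=
        abs_of_nonneg (intervalIntegral.integral_nonneg hcd fun x _ => abs_nonneg _)
    _ ≤ ∫ x in c..d, f x := intervalIntegral.integral_mono_on hcd hint hf hle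

/-- Projection estimate (Lemma 3.5): for a C¹ nonnegative radius function `ρ : [0,d] → ℝ`,
`n ∫₀^d ρ^{n-1} √(1+ρ'²) dx ≥ (max ρ)^n - (min ρ)^n`. -/
theorem stmt_3 (n : ℕ) (hn : 2 ≤ n) (d : ℝ) (hd : 0 < d)
    (ρ ρ' : ℝ → ℝ)
    (hderiv : ∀ x ∈ Set.Icc 0 d, HasDerivWithinAt ρ (ρ' x) (Set.Icc 0 d) x)
    (hρ'c : ContinuousOn ρ' (Set.Icc 0 d))
    (hρ0 : ∀ x ∈ Set.Icc 0 d, 0 ≤ ρ x) :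
    sSup (ρ '' Set.Icc 0 d) ^ n - sInf (ρ '' Set.Icc 0 d) ^ n ≤
      n * ∫ x in (0:ℝ)..d, ρ x ^ (n - 1) * Real.sqrt (1 + ρ' x ^ 2) := by
  have hc : ContinuousOn ρ (Set.Icc 0 d) := fun x hx => (hderiv x hx).continuousWithinAt
  have hne : (Set.Icc 0 d).Nonempty := Set.nonempty_Icc.2 hd.le
  obtain ⟨a, ha, hsup⟩ := isCompact_Icc.exists_sSup_image_eq hne hc
  obtain ⟨b, hb, hinf⟩ := isCompact_Icc.exists_sInf_image_eq hne hc
  rw [hsup, hinf, ← intervalIntegral.integral_const_mul]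
  refine sub_le_integral_of_abs_deriv_le (g := fun x => ρ x ^ n)
    (g' := fun x => n * ρ x ^ (n - 1) * ρ' x) hd.le (fun x hx => (hderiv x hx).fun_pow n)
    (by fun_prop) (ContinuousOn.intervalIntegrable_of_Icc hd.le (by fun_prop))
    (fun x hx => ?_) ha hb
  have hpow : 0 ≤ (n : ℝ) * ρ x ^ (n - 1) := mul_nonneg n.cast_nonneg (pow_nonneg (hρ0 x hx) _)
  rw [abs_mul, abs_of_nonneg hpow, ← mul_assoc]
  exact mul_le_mul_of_nonneg_left (Real.abs_le_sqrt (by linarith)) hpow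
end

section
/- Let n ≥ 2 be an integer, d > 0, V > 0, and let ρ : [0,d] → ℝ be a C¹ nonnegative function such that ρ(s) = 0 for some s ∈ [0,d] (the surface pinches off) and ω_n·∫₀^d ρ(x)^n dx ≥ V (the enclosed volume is at least V). Then the surface area satisfies n·ω_n·∫₀^d ρ^{n−1}√(1+ρ'²) dx > V/d. -/
open MeasureTheory

/-- A function vanishing at a point of `[a, b]` is bounded there by its total variation. -/
lemma abs_le_integral_abs_deriv_of_eq_zero {f f' : ℝ → ℝ} {a b s x : ℝ}
    (hf : ∀ y ∈ Set.Icc a b, HasDerivWithinAt f (f' y) (Set.Icc a b) y)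
    (hf' : ContinuousOn f' (Set.Icc a b)) (hs : s ∈ Set.Icc a b) (hx : x ∈ Set.Icc a b)
    (hfs : f s = 0) : |f x| ≤ ∫ y in a..b, |f' y| := by
  have hab : a ≤ b := hs.1.trans hs.2
  have hsub : Set.uIcc s x ⊆ Set.Icc a b := Set.uIcc_subset_Icc hs hx
  have hftc : ∫ y in s..x, f' y = f x - f s := by
    refine intervalIntegral.integral_eq_sub_of_hasDeriv_right
      (fun y hy => ((hf y (hsub hy)).continuousWithinAt).mono hsub) (fun y hy => ?_)
      (hf'.mono hsub).intervalIntegrable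
    have hy' : y ∈ Set.Ioo a b :=
      ⟨(le_min hs.1 hx.1).trans_lt hy.1, hy.2.trans_le (max_le hs.2 hx.2)⟩
    exact ((hf y (Set.Ioo_subset_Icc_self hy')).hasDerivAt
      (Icc_mem_nhds hy'.1 hy'.2)).hasDerivWithinAt
  have habs : IntervalIntegrable (fun y => |f' y|) volume a b := by
    refine ContinuousOn.intervalIntegrable ?_
    rw [Set.uIcc_of_le hab]
    exact hf'.abs
  have hsub' : Set.uIoc s x ⊆ Set.uIoc a b := by
    rw [Set.uIoc_of_le hab]
    exact Set.Ioc_subset_Ioc (le_min hs.1 hx.1) (max_le hs.2 hx.2)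
  calc |f x| = |∫ y in s..x, f' y| := by rw [hftc, hfs, sub_zero]
    _ ≤ |∫ y in s..x, (|f' y|)| :=
      intervalIntegral.norm_integral_le_abs_integral_norm (f := f')
    _ ≤ |∫ y in a..b, (|f' y|)| :=
      intervalIntegral.abs_integral_mono_interval hsub'
        (Filter.Eventually.of_forall fun y => abs_nonneg _) habs
    _ = ∫ y in a..b, (|f' y|) :=
      abs_of_nonneg (intervalIntegral.integral_nonneg hab fun y _ => abs_nonneg _)

/-- First half of Lemma 3.5: if a rotationally symmetric hypersurface with C¹ nonnegative
radius function `ρ : [0,d] → ℝ` pinches off (`ρ(s) = 0` for some `s ∈ [0,d]`) while enclosing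
volume at least `V`, then its surface area `n ω_n ∫₀^d ρ^{n-1}√(1+ρ'²) dx` exceeds `V/d`. -/
theorem stmt_4 (n : ℕ) (hn : 2 ≤ n) (d V : ℝ) (hd : 0 < d) (hV : 0 < V)
    (ρ ρ' : ℝ → ℝ)
    (hderiv : ∀ x ∈ Set.Icc 0 d, HasDerivWithinAt ρ (ρ' x) (Set.Icc 0 d) x)
    (hρ'c : ContinuousOn ρ' (Set.Icc 0 d))
    (hρ0 : ∀ x ∈ Set.Icc 0 d, 0 ≤ ρ x)
    (hpinch : ∃ s ∈ Set.Icc 0 d, ρ s = 0)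
    (ω : ℝ) (hω : ω = (volume (Metric.ball (0 : EuclideanSpace ℝ (Fin n)) 1)).toReal)
    (hvol : V ≤ ω * ∫ x in (0:ℝ)..d, ρ x ^ n) :
    V / d < n * ω * ∫ x in (0:ℝ)..d, ρ x ^ (n - 1) * Real.sqrt (1 + ρ' x ^ 2) := by
  obtain ⟨s, hs, hρs⟩ := hpinch
  have hρc : ContinuousOn ρ (Set.Icc 0 d) := fun x hx => (hderiv x hx).continuousWithinAt
  have hωpos : 0 < ω := by
    refine lt_of_le_of_ne (hω ▸ ENNReal.toReal_nonneg) fun h => ?_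
    rw [← h, zero_mul] at hvol
    linarith
  have hn0 : n ≠ 0 := by omega
  obtain ⟨c, hc, hρc_pos⟩ : ∃ c ∈ Set.Icc 0 d, 0 < ρ c := by
    by_contra! h
    have hzero : ∫ x in (0:ℝ)..d, ρ x ^ n = 0 := by
      rw [intervalIntegral.integral_congr (g := fun _ => 0), intervalIntegral.integral_zero]
      intro x hx
      rw [Set.uIcc_of_le hd.le] at hx
      simp [le_antisymm (h x hx) (hρ0 x hx), hn0]
    rw [hzero, mul_zero] at hvol
    linarith
  have hpow_le : ∀ x ∈ Set.Icc 0 d,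
      ρ x ^ n ≤ n * ∫ y in (0:ℝ)..d, ρ y ^ (n - 1) * |ρ' y| := by
    intro x hx
    have h := abs_le_integral_abs_deriv_of_eq_zero
      (f := fun y => ρ y ^ n) (f' := fun y => n * ρ y ^ (n - 1) * ρ' y)
      (fun y hy => (hderiv y hy).fun_pow n)
      ((continuousOn_const.mul (hρc.pow _)).mul hρ'c) hs hx (by simp [hρs, hn0])
    refine (le_abs_self _).trans (h.trans_eq ?_)
    rw [← intervalIntegral.integral_const_mul]
    refine intervalIntegral.integral_congr fun y hy => ?_
    rw [Set.uIcc_of_le hd.le] at hy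
    simp only [abs_mul, Nat.abs_cast, abs_of_nonneg (pow_nonneg (hρ0 y hy) (n - 1)), mul_assoc]
  have hvol_le : ∫ x in (0:ℝ)..d, ρ x ^ n ≤
      d * (n * ∫ y in (0:ℝ)..d, ρ y ^ (n - 1) * |ρ' y|) := by
    have h := intervalIntegral.integral_mono_on hd.le
      ((hρc.pow n).intervalIntegrable_of_Icc hd.le) (intervalIntegrable_const (μ := volume)) hpow_le
    rwa [intervalIntegral.integral_const, sub_zero, smul_eq_mul] at h
  have habs_lt : ∀ t : ℝ, |t| < Real.sqrt (1 + t ^ 2) := fun t =>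
    Real.lt_sqrt_of_sq_lt (by rw [sq_abs]; linarith)
  have hlt : ∫ y in (0:ℝ)..d, ρ y ^ (n - 1) * |ρ' y| <
      ∫ x in (0:ℝ)..d, ρ x ^ (n - 1) * Real.sqrt (1 + ρ' x ^ 2) :=
    intervalIntegral.integral_lt_integral_of_continuousOn_of_le_of_exists_lt hd
      ((hρc.pow _).mul hρ'c.abs)
      ((hρc.pow _).mul (continuousOn_const.add (hρ'c.pow 2)).sqrt)
      (fun x hx => mul_le_mul_of_nonneg_left (habs_lt _).le
        (pow_nonneg (hρ0 x (Set.Ioc_subset_Icc_self hx)) _))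
      ⟨c, hc, mul_lt_mul_of_pos_left (habs_lt _) (pow_pos hρc_pos _)⟩
  have hnω : 0 < n * ω := by positivity
  refine lt_of_le_of_lt ?_ (mul_lt_mul_of_pos_left hlt hnω)
  rw [div_le_iff₀ hd]
  calc V ≤ ω * ∫ x in (0:ℝ)..d, ρ x ^ n := hvol
    _ ≤ ω * (d * (n * ∫ y in (0:ℝ)..d, ρ y ^ (n - 1) * |ρ' y|)) := by gcongr
    _ = _ := by ring
end

section
/- Let n ≥ 2 be an integer, d > 0, a > 0, S > 0, and let ρ : [0,d] → ℝ be a C¹ nonnegative function with min_{[0,d]} ρ ≤ a and with surface area n·ω_n·∫₀^d ρ^{n−1}√(1+ρ'²) dx = S. Then max_{[0,d]} ρ < a + (S/ω_n)^{1/n}. -/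
open MeasureTheory

/-- The oscillation of a function is controlled by the integral of the absolute value of its
derivative over any interval containing the two points. -/
lemma abs_sub_le_integral_abs_of_hasDerivWithinAt {F F' : ℝ → ℝ} {d x y : ℝ} (hd : 0 ≤ d)
    (hF : ∀ z ∈ Set.Icc 0 d, HasDerivWithinAt F (F' z) (Set.Icc 0 d) z)
    (hF' : ContinuousOn F' (Set.Icc 0 d)) (hx : x ∈ Set.Icc 0 d) (hy : y ∈ Set.Icc 0 d) :
    |F x - F y| ≤ ∫ z in (0:ℝ)..d, |F' z| := by
  have hsub : Set.uIcc y x ⊆ Set.Icc 0 d := Set.uIcc_subset_Icc hy hx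
  have hftc : ∫ z in y..x, F' z = F x - F y := by
    refine intervalIntegral.integral_eq_sub_of_hasDeriv_right
      (fun z hz => ((hF z (hsub hz)).continuousWithinAt).mono hsub) (fun z hz => ?_)
      (hF'.mono hsub).intervalIntegrable
    have h0 : 0 < z := lt_of_le_of_lt (le_min hy.1 hx.1) hz.1
    have h1 : z < d := lt_of_lt_of_le hz.2 (max_le hy.2 hx.2)
    exact ((hF z ⟨h0.le, h1.le⟩).hasDerivAt (Icc_mem_nhds h0 h1)).hasDerivWithinAt
  have hint : IntervalIntegrable (fun z => |F' z|) volume 0 d :=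
    ContinuousOn.intervalIntegrable (by rw [Set.uIcc_of_le hd]; exact hF'.abs)
  have hI : Set.uIoc y x ⊆ Set.uIoc 0 d := by
    rw [Set.uIoc_of_le hd]
    exact Set.Ioc_subset_Ioc (le_min hy.1 hx.1) (max_le hy.2 hx.2)
  calc |F x - F y| = |∫ z in y..x, F' z| := by rw [hftc]
    _ ≤ |∫ z in y..x, (|F' z|)| := by
      simpa only [Real.norm_eq_abs] using
        intervalIntegral.norm_integral_le_abs_integral_norm (f := F') (a := y) (b := x) (μ := volume)
    _ ≤ |∫ z in (0:ℝ)..d, (|F' z|)| :=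
      intervalIntegral.abs_integral_mono_interval hI
        (Filter.Eventually.of_forall fun z => abs_nonneg _) hint
    _ = ∫ z in (0:ℝ)..d, |F' z| :=
      abs_of_nonneg (intervalIntegral.integral_nonneg hd fun z _ => abs_nonneg _)

lemma abs_lt_sqrt_one_add_sq (t : ℝ) : |t| < Real.sqrt (1 + t ^ 2) := by
  rw [← Real.sqrt_sq_eq_abs]
  exact Real.sqrt_lt_sqrt (sq_nonneg t) (by linarith)

/-- Second half of Lemma 3.5: if the C¹ nonnegative radius function `ρ : [0,d] → ℝ` satisfies
`min ρ ≤ a` and the surface area `n ω_n ∫₀^d ρ^{n-1}√(1+ρ'²) dx` equals `S`, then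
`max ρ < a + (S/ω_n)^{1/n}`. -/
theorem stmt_5 (n : ℕ) (hn : 2 ≤ n) (d a S : ℝ) (hd : 0 < d) (ha : 0 < a) (hS : 0 < S)
    (ρ ρ' : ℝ → ℝ)
    (hderiv : ∀ x ∈ Set.Icc 0 d, HasDerivWithinAt ρ (ρ' x) (Set.Icc 0 d) x)
    (hρ'c : ContinuousOn ρ' (Set.Icc 0 d))
    (hρ0 : ∀ x ∈ Set.Icc 0 d, 0 ≤ ρ x)
    (ω : ℝ) (hω : ω = (volume (Metric.ball (0 : EuclideanSpace ℝ (Fin n)) 1)).toReal)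
    (hmin : sInf (ρ '' Set.Icc 0 d) ≤ a)
    (harea : n * ω * ∫ x in (0:ℝ)..d, ρ x ^ (n - 1) * Real.sqrt (1 + ρ' x ^ 2) = S) :
    sSup (ρ '' Set.Icc 0 d) < a + (S / ω) ^ ((1:ℝ) / n) := by
  have hω0 : 0 < ω := by
    rw [hω]
    exact ENNReal.toReal_pos (Metric.measure_ball_pos _ _ one_pos).ne' measure_ball_lt_top.ne
  have hn0 : (0:ℝ) < n := by exact_mod_cast (by omega : 0 < n)
  have hρc : ContinuousOn ρ (Set.Icc 0 d) := fun z hz => (hderiv z hz).continuousWithinAt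
  have hne : (Set.Icc 0 d).Nonempty := Set.nonempty_Icc.2 hd.le
  obtain ⟨x, hx, hxs, -⟩ := isCompact_Icc.exists_sSup_image_eq_and_ge hne hρc
  obtain ⟨y, hy, hys, -⟩ := isCompact_Icc.exists_sInf_image_eq_and_le hne hρc
  rw [hys] at hmin
  rw [hxs]
  have hpos : 0 < (S / ω) ^ ((1:ℝ) / n) := Real.rpow_pos_of_pos (div_pos hS hω0) _
  rcases le_or_gt (ρ x) a with hxa | hxa
  · linarith
  have hosc := abs_sub_le_integral_abs_of_hasDerivWithinAt (F := fun z => ρ z ^ n) hd.le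
    (fun z hz => (hderiv z hz).pow n) (by fun_prop) hx hy
  have hlt : ∫ z in (0:ℝ)..d, |(n:ℝ) * ρ z ^ (n - 1) * ρ' z| <
      ∫ z in (0:ℝ)..d, n * (ρ z ^ (n - 1) * Real.sqrt (1 + ρ' z ^ 2)) := by
    have habs : ∀ z ∈ Set.Icc 0 d,
        |(n:ℝ) * ρ z ^ (n - 1) * ρ' z| = n * (ρ z ^ (n - 1) * |ρ' z|) := fun z hz => by
      rw [abs_mul, abs_of_nonneg (mul_nonneg hn0.le (pow_nonneg (hρ0 z hz) _)), mul_assoc]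
    refine intervalIntegral.integral_lt_integral_of_continuousOn_of_le_of_exists_lt hd
      (by fun_prop) (by fun_prop) (fun z hz => ?_) ⟨x, hx, ?_⟩
    · have hz' := Set.Ioc_subset_Icc_self hz
      rw [habs z hz']
      have := pow_nonneg (hρ0 z hz') (n - 1)
      gcongr
      exact (abs_lt_sqrt_one_add_sq _).le
    · rw [habs x hx]
      have := pow_pos (ha.trans hxa) (n - 1)
      gcongr
      exact abs_lt_sqrt_one_add_sq _
  rw [intervalIntegral.integral_const_mul] at hlt
  have hSω : S / ω = n * ∫ z in (0:ℝ)..d, ρ z ^ (n - 1) * Real.sqrt (1 + ρ' z ^ 2) := by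
    rw [← harea]
    field_simp
  rw [← hSω] at hlt
  have hyx : 0 ≤ ρ x - ρ y := by linarith
  have hsuper : (ρ x - ρ y) ^ n ≤ ρ x ^ n - ρ y ^ n := by
    have := pow_add_pow_le hyx (hρ0 y hy) (by omega : n ≠ 0)
    rw [sub_add_cancel] at this
    linarith
  have hpow : (ρ x - ρ y) ^ n < S / ω :=
    hsuper.trans_lt ((le_abs_self _).trans_lt (hosc.trans_lt hlt))
  have hroot : ρ x - ρ y < (S / ω) ^ ((1:ℝ) / n) := by
    rw [one_div, Real.lt_rpow_inv_iff_of_pos hyx (div_pos hS hω0).le hn0, Real.rpow_natCast]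
    exact hpow
  linarith
end

section
/- Let n ≥ 2 be an integer, d > 0, and let ρ : [0,d] → ℝ be a C² positive function with ρ'(0) = ρ'(d) = 0. Then ∫₀^d −ρ''(x)·ρ(x)^{n−1}/(1+ρ'(x)²) dx = (n−1)·∫₀^d ρ(x)^{n−2}·ρ'(x)·arctan(ρ'(x)) dx. -/
open MeasureTheory

/-- Integration-by-parts identity in the proof of Lemma 4.2: for a C² positive radius
function `ρ : [0,d] → ℝ` with free Neumann boundary conditions `ρ'(0) = ρ'(d) = 0`,
`∫₀^d -ρ'' ρ^{n-1}/(1+ρ'²) dx = (n-1) ∫₀^d ρ^{n-2} ρ' arctan(ρ') dx`. -/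
theorem stmt_7 (n : ℕ) (hn : 2 ≤ n) (d : ℝ) (hd : 0 < d)
    (ρ ρ' ρ'' : ℝ → ℝ)
    (hderiv : ∀ x ∈ Set.Icc 0 d, HasDerivWithinAt ρ (ρ' x) (Set.Icc 0 d) x)
    (hderiv' : ∀ x ∈ Set.Icc 0 d, HasDerivWithinAt ρ' (ρ'' x) (Set.Icc 0 d) x)
    (hρ''c : ContinuousOn ρ'' (Set.Icc 0 d))
    (hρpos : ∀ x ∈ Set.Icc 0 d, 0 < ρ x)
    (hb0 : ρ' 0 = 0) (hbd : ρ' d = 0) :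
    ∫ x in (0:ℝ)..d, -ρ'' x * ρ x ^ (n - 1) / (1 + ρ' x ^ 2) =
      (n - 1 : ℝ) * ∫ x in (0:ℝ)..d, ρ x ^ (n - 2) * ρ' x * Real.arctan (ρ' x) := by
  have hI : Set.uIcc 0 d = Set.Icc 0 d := Set.uIcc_of_le hd.le
  have hρc : ContinuousOn ρ (Set.Icc 0 d) := fun x hx => (hderiv x hx).continuousWithinAt
  have hρ'c : ContinuousOn ρ' (Set.Icc 0 d) := fun x hx => (hderiv' x hx).continuousWithinAt
  have hpow : ∀ x ∈ Set.uIcc 0 d, HasDerivWithinAt (fun y => ρ y ^ (n - 1))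
      (((n : ℝ) - 1) * (ρ x ^ (n - 2) * ρ' x)) (Set.uIcc 0 d) x := by
    rw [hI]
    intro x hx
    refine ((hderiv x hx).fun_pow (n - 1)).congr_deriv ?_
    rw [Nat.cast_sub (by lia), Nat.sub_sub]
    push_cast
    ring
  have harctan : ∀ x ∈ Set.uIcc 0 d, HasDerivWithinAt (fun y => Real.arctan (ρ' y))
      (1 / (1 + ρ' x ^ 2) * ρ'' x) (Set.uIcc 0 d) x := by
    rw [hI]
    exact fun x hx => (hderiv' x hx).arctan
  have hparts := intervalIntegral.integral_mul_deriv_eq_deriv_mul_of_hasDerivWithinAt hpow harctan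
    (ContinuousOn.intervalIntegrable (by rw [hI]; fun_prop))
    (ContinuousOn.intervalIntegrable (by
      rw [hI]
      exact (continuousOn_const.div (by fun_prop) fun x _ => by positivity).mul hρ''c))
  calc ∫ x in (0:ℝ)..d, -ρ'' x * ρ x ^ (n - 1) / (1 + ρ' x ^ 2)
      = -∫ x in (0:ℝ)..d, ρ x ^ (n - 1) * (1 / (1 + ρ' x ^ 2) * ρ'' x) := by
        rw [← intervalIntegral.integral_neg]
        congr 1 with x
        ring
    _ = ∫ x in (0:ℝ)..d, ((n : ℝ) - 1) * (ρ x ^ (n - 2) * ρ' x) * Real.arctan (ρ' x) := by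
        rw [hparts]
        simp [hb0, hbd]
    _ = _ := by
        simp_rw [mul_assoc, intervalIntegral.integral_const_mul]
end

section
/- Let n ≥ 2 be an integer, d > 0, 0 < r ≤ R, and let ρ : [0,d] → ℝ be a C² function with r ≤ ρ(x) ≤ R for all x and ρ'(0) = ρ'(d) = 0. Then ∫₀^d ( −ρ''·ρ^{n−1}/(1+ρ'²) + (n−1)·ρ^{n−2} ) dx ≤ (n−1)·d·R^{n−2} + ((n−1)π/(2r))·∫₀^d ρ^{n−1}√(1+ρ'²) dx. -/
open MeasureTheory

/-- Pointwise bound for the integrand left after integrating the second-order term by parts. -/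
lemma pow_mul_one_add_arctan_mul_le (m : ℕ) {r R y p : ℝ} (hr : 0 < r) (hry : r ≤ y)
    (hyR : y ≤ R) :
    y ^ m * (1 + Real.arctan p * p) ≤
      R ^ m + Real.pi / (2 * r) * (y ^ (m + 1) * Real.sqrt (1 + p ^ 2)) := by
  have hy : 0 < y := hr.trans_le hry
  have h_abs : |p| ≤ Real.sqrt (1 + p ^ 2) := Real.abs_le_sqrt (by linarith)
  have h_arctan : |Real.arctan p| ≤ Real.pi / 2 :=
    abs_le.2 ⟨(Real.neg_pi_div_two_lt_arctan p).le, (Real.arctan_lt_pi_div_two p).le⟩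
  have h_mul : Real.arctan p * p ≤ Real.pi / 2 * Real.sqrt (1 + p ^ 2) := by
    refine (le_abs_self _).trans ?_
    rw [abs_mul]
    gcongr
  have h_ratio : 1 ≤ y / r := (one_le_div hr).2 hry
  calc y ^ m * (1 + Real.arctan p * p)
      = y ^ m + y ^ m * (Real.arctan p * p) := by ring
    _ ≤ R ^ m + y ^ m * (Real.pi / 2 * Real.sqrt (1 + p ^ 2)) := by gcongr
    _ ≤ R ^ m + y / r * (y ^ m * (Real.pi / 2 * Real.sqrt (1 + p ^ 2))) := by
        gcongr R ^ m + ?_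
        exact le_mul_of_one_le_left (by positivity) h_ratio
    _ = _ := by
        field_simp
        ring

/-- Upper bound of Lemma 4.2 for the total mean curvature: for a C² radius function
`ρ : [0,d] → ℝ` with `r ≤ ρ ≤ R` and `ρ'(0) = ρ'(d) = 0`,
`∫₀^d (-ρ'' ρ^{n-1}/(1+ρ'²) + (n-1) ρ^{n-2}) dx
  ≤ (n-1) d R^{n-2} + ((n-1)π/(2r)) ∫₀^d ρ^{n-1}√(1+ρ'²) dx`. -/
theorem stmt_8 (n : ℕ) (hn : 2 ≤ n) (d r R : ℝ) (hd : 0 < d) (hr : 0 < r) (hrR : r ≤ R)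
    (ρ ρ' ρ'' : ℝ → ℝ)
    (hderiv : ∀ x ∈ Set.Icc 0 d, HasDerivWithinAt ρ (ρ' x) (Set.Icc 0 d) x)
    (hderiv' : ∀ x ∈ Set.Icc 0 d, HasDerivWithinAt ρ' (ρ'' x) (Set.Icc 0 d) x)
    (hρ''c : ContinuousOn ρ'' (Set.Icc 0 d))
    (hbound : ∀ x ∈ Set.Icc 0 d, r ≤ ρ x ∧ ρ x ≤ R)
    (hb0 : ρ' 0 = 0) (hbd : ρ' d = 0) :
    ∫ x in (0:ℝ)..d, (-ρ'' x * ρ x ^ (n - 1) / (1 + ρ' x ^ 2) + (n - 1 : ℝ) * ρ x ^ (n - 2)) ≤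
      (n - 1 : ℝ) * d * R ^ (n - 2) +
        ((n - 1 : ℝ) * Real.pi / (2 * r)) *
          ∫ x in (0:ℝ)..d, ρ x ^ (n - 1) * Real.sqrt (1 + ρ' x ^ 2) := by
  obtain ⟨m, rfl⟩ : ∃ m, n = m + 2 := ⟨n - 2, by omega⟩
  simp only [show m + 2 - 1 = m + 1 by omega, Nat.add_sub_cancel]
  have hρc : ContinuousOn ρ (Set.Icc 0 d) := fun x hx => (hderiv x hx).continuousWithinAt
  have hρ'c : ContinuousOn ρ' (Set.Icc 0 d) := fun x hx => (hderiv' x hx).continuousWithinAt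
  have h_arctan : ContinuousOn (fun x => Real.arctan (ρ' x)) (Set.Icc 0 d) :=
    Real.continuous_arctan.comp_continuousOn hρ'c
  have h_pos : ∀ p : ℝ, 1 + p ^ 2 ≠ 0 := fun p => by positivity
  have h_curv : ContinuousOn (fun x => -ρ'' x * ρ x ^ (m + 1) / (1 + ρ' x ^ 2))
      (Set.Icc 0 d) :=
    (hρ''c.neg.mul (hρc.pow _)).div (continuousOn_const.add (hρ'c.pow 2)) fun x _ => h_pos _
  set G : ℝ → ℝ := fun x => -ρ'' x * ρ x ^ (m + 1) / (1 + ρ' x ^ 2) -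
    Real.arctan (ρ' x) * ((m + 1) * ρ x ^ m * ρ' x) with hG
  have hGc : ContinuousOn G (Set.Icc 0 d) :=
    h_curv.sub (h_arctan.mul ((continuousOn_const.mul (hρc.pow m)).mul hρ'c))
  have h_area : ContinuousOn (fun x => ρ x ^ (m + 1) * Real.sqrt (1 + ρ' x ^ 2))
      (Set.Icc 0 d) :=
    (hρc.pow _).mul (continuousOn_const.add (hρ'c.pow 2)).sqrt
  have hGi : IntervalIntegrable G volume 0 d := hGc.intervalIntegrable_of_Icc hd.le
  have h_area_int := h_area.intervalIntegrable_of_Icc (μ := volume) hd.le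
  have hG0 : ∫ x in (0:ℝ)..d, G x = 0 := by
    rw [intervalIntegral.integral_eq_sub_of_hasDerivAt_of_le (a := 0) (b := d)
      (f := fun x => -(Real.arctan (ρ' x) * ρ x ^ (m + 1))) hd.le
      (h_arctan.mul (hρc.pow _)).neg ?_ hGi]
    · simp [hb0, hbd]
    · intro x hx
      have hx' := Set.Ioo_subset_Icc_self hx
      have hnhds := Icc_mem_nhds hx.1 hx.2
      refine HasDerivAt.congr_deriv (((hderiv' x hx').hasDerivAt hnhds).arctan.mul
        (((hderiv x hx').hasDerivAt hnhds).pow (m + 1))).neg ?_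
      simp only [hG, Nat.add_sub_cancel, Pi.pow_apply]
      push_cast
      have := h_pos (ρ' x)
      field_simp
      ring
  set c : ℝ := (((m + 2 : ℕ) : ℝ) - 1) * Real.pi / (2 * r) with hc
  calc ∫ x in (0:ℝ)..d, (-ρ'' x * ρ x ^ (m + 1) / (1 + ρ' x ^ 2) +
        (((m + 2 : ℕ) : ℝ) - 1) * ρ x ^ m)
      ≤ ∫ x in (0:ℝ)..d, (G x + ((((m + 2 : ℕ) : ℝ) - 1) * R ^ m +
          c * (ρ x ^ (m + 1) * Real.sqrt (1 + ρ' x ^ 2)))) := by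
        refine intervalIntegral.integral_mono_on hd.le
          ((h_curv.add (continuousOn_const.mul (hρc.pow m))).intervalIntegrable_of_Icc hd.le)
          (hGi.add (intervalIntegrable_const.add (h_area_int.const_mul c))) fun x hx => ?_
        have h := mul_le_mul_of_nonneg_left (pow_mul_one_add_arctan_mul_le m (p := ρ' x) hr
          (hbound x hx).1 (hbound x hx).2) (by positivity : (0 : ℝ) ≤ m + 1)
        simp only [hG, hc]
        push_cast
        linear_combination h
    _ = _ := by
        rw [intervalIntegral.integral_add hGi
            (intervalIntegrable_const.add (h_area_int.const_mul c)),
          intervalIntegral.integral_add intervalIntegrable_const (h_area_int.const_mul c),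
          hG0, intervalIntegral.integral_const, intervalIntegral.integral_const_mul]
        simp only [smul_eq_mul]
        ring
end

section
/- Let n ≥ 2 be an integer, d > 0, r > 0, and let ρ : [0,d] → ℝ be a C² function with ρ(x) ≥ r for all x and ρ'(0) = ρ'(d) = 0. Then ∫₀^d ( −ρ''·ρ^{n−1}/(1+ρ'²) + (n−1)·ρ^{n−2} ) dx ≥ (n−1)·d·r^{n−2} > 0. -/
open MeasureTheory

theorem mul_arctan_nonneg (x : ℝ) : 0 ≤ x * Real.arctan x := by
  rcases le_total 0 x with hx | hx
  · exact mul_nonneg hx (Real.arctan_nonneg.2 hx)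
  · exact mul_nonneg_of_nonpos_of_nonpos hx (Real.arctan_le_zero.2 hx)

/-- Lower bound of Lemma 4.2 for the total mean curvature: for a C² radius function
`ρ : [0,d] → ℝ` with `ρ ≥ r > 0` and `ρ'(0) = ρ'(d) = 0`,
`∫₀^d (-ρ'' ρ^{n-1}/(1+ρ'²) + (n-1) ρ^{n-2}) dx ≥ (n-1) d r^{n-2} > 0`. -/
theorem stmt_9 (n : ℕ) (hn : 2 ≤ n) (d r : ℝ) (hd : 0 < d) (hr : 0 < r)
    (ρ ρ' ρ'' : ℝ → ℝ)
    (hderiv : ∀ x ∈ Set.Icc 0 d, HasDerivWithinAt ρ (ρ' x) (Set.Icc 0 d) x)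
    (hderiv' : ∀ x ∈ Set.Icc 0 d, HasDerivWithinAt ρ' (ρ'' x) (Set.Icc 0 d) x)
    (hρ''c : ContinuousOn ρ'' (Set.Icc 0 d))
    (hbound : ∀ x ∈ Set.Icc 0 d, r ≤ ρ x)
    (hb0 : ρ' 0 = 0) (hbd : ρ' d = 0) :
    (n - 1 : ℝ) * d * r ^ (n - 2) ≤
        ∫ x in (0:ℝ)..d, (-ρ'' x * ρ x ^ (n - 1) / (1 + ρ' x ^ 2) + (n - 1 : ℝ) * ρ x ^ (n - 2))
      ∧ 0 < (n - 1 : ℝ) * d * r ^ (n - 2) := by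
  obtain ⟨m, rfl⟩ : ∃ m, n = m + 2 := ⟨n - 2, by omega⟩
  have hcast : ((m + 2 : ℕ) : ℝ) - 1 = m + 1 := by push_cast; ring
  rw [hcast, show m + 2 - 1 = m + 1 from rfl, Nat.add_sub_cancel]
  refine ⟨?_, by positivity⟩
  have hρc : ContinuousOn ρ (Set.Icc 0 d) := fun x hx => (hderiv x hx).continuousWithinAt
  have hρ'c : ContinuousOn ρ' (Set.Icc 0 d) := fun x hx => (hderiv' x hx).continuousWithinAt
  have hint : ContinuousOn (fun x => -ρ'' x * ρ x ^ (m + 1) / (1 + ρ' x ^ 2) +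
      ((m : ℝ) + 1) * ρ x ^ m) (Set.Icc 0 d) :=
    ((hρ''c.neg.mul (hρc.pow _)).div (continuousOn_const.add (hρ'c.pow 2))
      fun x _ => (add_pos_of_pos_of_nonneg one_pos (sq_nonneg (ρ' x))).ne').add (continuousOn_const.mul (hρc.pow m))
  have hderivG : ∀ x ∈ Set.Ioo 0 d, HasDerivAt
      (fun x => ((m : ℝ) + 1) * r ^ m * x - Real.arctan (ρ' x) * ρ x ^ (m + 1))
      (((m : ℝ) + 1) * r ^ m - (1 / (1 + ρ' x ^ 2) * ρ'' x * ρ x ^ (m + 1) +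
        Real.arctan (ρ' x) * (((m : ℝ) + 1) * ρ x ^ m * ρ' x))) x := by
    intro x hx
    have hmem := Set.Ioo_subset_Icc_self hx
    have h1 := (hderiv x hmem).hasDerivAt (Icc_mem_nhds hx.1 hx.2)
    have h2 := (hderiv' x hmem).hasDerivAt (Icc_mem_nhds hx.1 hx.2)
    have h3 := ((hasDerivAt_id x).const_mul (((m : ℝ) + 1) * r ^ m)).sub
      (h2.arctan.mul (h1.pow (m + 1)))
    simpa using! h3
  have hcontG : ContinuousOn
      (fun x => ((m : ℝ) + 1) * r ^ m * x - Real.arctan (ρ' x) * ρ x ^ (m + 1)) (Set.Icc 0 d) :=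
    (continuousOn_const.mul continuousOn_id).sub
      ((Real.continuous_arctan.comp_continuousOn hρ'c).mul (hρc.pow (m + 1)))
  have hle := intervalIntegral.sub_le_integral_of_hasDeriv_right_of_le hd.le hcontG
    (fun x hx => (hderivG x hx).hasDerivWithinAt) hint.integrableOn_Icc (fun x hx => ?_)
  · simp only [hb0, hbd, Real.arctan_zero] at hle
    linarith
  · have hρ := hbound x (Set.Ioo_subset_Icc_self hx)
    have hρ0 : 0 < ρ x := hr.trans_le hρ
    have hpow : ((m : ℝ) + 1) * r ^ m ≤ ((m : ℝ) + 1) * ρ x ^ m := by gcongr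
    have hnonneg : 0 ≤ ((m : ℝ) + 1) * ρ x ^ m * (ρ' x * Real.arctan (ρ' x)) :=
      mul_nonneg (by positivity) (mul_arctan_nonneg _)
    have heq : -ρ'' x * ρ x ^ (m + 1) / (1 + ρ' x ^ 2) =
        -(1 / (1 + ρ' x ^ 2) * ρ'' x * ρ x ^ (m + 1)) := by ring
    rw [heq]
    linarith
end
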